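/- arXiv:math/0701219 — 3 statements merged into one kernel-verified Lean document; each statement's English description precedes it below -/
import Mathlib

section
/- Let α ∈ [0,1] and let φ : ℝ → ℝ be bounded and continuous. For every t > 0 the one-sided spatial derivatives ∂_x Q_t φ(t,0+) := lim_{h→0+} (Q_t φ(h) − Q_t φ(0))/h and ∂_x Q_t φ(t,0−) := lim_{h→0−} (Q_t φ(h) − Q_t φ(0))/h exist, and they satisfy the transmission condition α·∂_x Q_t φ(t,0+) = (1−α)·∂_x Q_t φ(t,0−). -/
open MeasureTheory Real Filter

/-- The Gaussian heat kernel `p(t,x,y) = (2πt)^{-1/2} exp(-(x-y)²/(2t))`. -/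
noncomputable def heatKernel (t x y : ℝ) : ℝ :=
  (Real.sqrt (2 * Real.pi * t))⁻¹ * Real.exp (-(x - y) ^ 2 / (2 * t))

/-- The transition kernel of the Skew Brownian motion of parameter `α`:
`q_α(t,x,y) = p(t,x,y) + (2α-1)·sgn(y)·(2πt)^{-1/2} exp(-(|x|+|y|)²/(2t))`. -/
noncomputable def skewKernel (α t x y : ℝ) : ℝ :=
  heatKernel t x y +
    (2 * α - 1) * Real.sign y * (Real.sqrt (2 * Real.pi * t))⁻¹ *
      Real.exp (-(|x| + |y|) ^ 2 / (2 * t))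

/-- The Skew Brownian motion semigroup applied to a function:
`Q_t φ(x) = ∫ q_α(t,x,y) φ(y) dy`. -/
noncomputable def skewSemigroup (α t : ℝ) (φ : ℝ → ℝ) (x : ℝ) : ℝ :=
  ∫ y, skewKernel α t x y * φ y

theorem Real.measurable_sign : Measurable Real.sign := by
  unfold Real.sign
  exact Measurable.ite measurableSet_Iio measurable_const
    (Measurable.ite measurableSet_Ioi measurable_const measurable_const)

theorem exp_neg_sub_sq_le {t : ℝ} (ht : 0 < t) (s b : ℝ) :
    Real.exp (-(s - b) ^ 2 / (2 * t)) ≤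
      Real.exp (s ^ 2 / (2 * t)) * Real.exp (-(1 / (4 * t)) * b ^ 2) := by
  rw [← Real.exp_add, Real.exp_le_exp]
  have key : s ^ 2 / (2 * t) + -(1 / (4 * t)) * b ^ 2 - -(s - b) ^ 2 / (2 * t)
      = (2 * s - b) ^ 2 / (4 * t) := by
    field_simp
    ring
  have : 0 ≤ (2 * s - b) ^ 2 / (4 * t) := by positivity
  linarith

theorem integrable_exp_neg_sub_sq_mul {t : ℝ} (ht : 0 < t) {b w : ℝ → ℝ} (hb : Measurable b)
    (hbabs : ∀ y, |b y| = |y|) (hw : Measurable w) {M : ℝ} (hM : ∀ y, |w y| ≤ M) (s : ℝ) :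
    Integrable fun y => Real.exp (-(s - b y) ^ 2 / (2 * t)) * w y := by
  have hint : Integrable fun y : ℝ => Real.exp (-(1 / (4 * t)) * y ^ 2) :=
    integrable_exp_neg_mul_sq (by positivity)
  refine ((hint.const_mul (Real.exp (s ^ 2 / (2 * t)))).mul_const M).mono'
    (by fun_prop) (Eventually.of_forall fun y => ?_)
  rw [Real.norm_eq_abs, abs_mul, Real.abs_exp, ← sq_abs y, ← hbabs y, sq_abs]
  exact mul_le_mul (exp_neg_sub_sq_le ht s (b y)) (hM y) (abs_nonneg _) (by positivity)

theorem hasDerivAt_integral_exp_neg_sub_sq_mul {t : ℝ} (ht : 0 < t) {b w : ℝ → ℝ}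
    (hb : Measurable b) (hbabs : ∀ y, |b y| = |y|) (hw : Measurable w) {M : ℝ}
    (hM : ∀ y, |w y| ≤ M) :
    HasDerivAt (fun s => ∫ y, Real.exp (-(s - b y) ^ 2 / (2 * t)) * w y)
      (∫ y, Real.exp (-y ^ 2 / (2 * t)) * (b y * w y / t)) 0 := by
  have h0 : Integrable fun y : ℝ => Real.exp (-(1 / (4 * t)) * y ^ 2) :=
    integrable_exp_neg_mul_sq (by positivity)
  have h1 : Integrable fun y : ℝ => |y| * Real.exp (-(1 / (4 * t)) * y ^ 2) := by
    have hy : Integrable fun y : ℝ => y * Real.exp (-(1 / (4 * t)) * y ^ 2) :=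
      integrable_mul_exp_neg_mul_sq (by positivity)
    simpa [abs_mul] using hy.abs
  have main := (hasDerivAt_integral_of_dominated_loc_of_deriv_le (μ := volume) (x₀ := (0 : ℝ))
    (s := Metric.ball 0 1)
    (F := fun s y => Real.exp (-(s - b y) ^ 2 / (2 * t)) * w y)
    (F' := fun s y => Real.exp (-(s - b y) ^ 2 / (2 * t)) * ((b y - s) / t) * w y)
    (bound := fun y => Real.exp (1 / (2 * t)) * M / t *
      (Real.exp (-(1 / (4 * t)) * y ^ 2) + |y| * Real.exp (-(1 / (4 * t)) * y ^ 2)))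
    (Metric.ball_mem_nhds _ one_pos)
    (Eventually.of_forall fun s =>
      (integrable_exp_neg_sub_sq_mul ht hb hbabs hw hM s).aestronglyMeasurable)
    (integrable_exp_neg_sub_sq_mul ht hb hbabs hw hM 0) (by fun_prop)
    (Eventually.of_forall fun y s hs => ?_) ((h0.add h1).const_mul _)
    (Eventually.of_forall fun y s _ => ?_)).2
  · refine main.congr_deriv (integral_congr_ae (Eventually.of_forall fun y => ?_))
    have hy : (0 - b y) ^ 2 = y ^ 2 := by rw [zero_sub, neg_sq, ← sq_abs, hbabs, sq_abs]
    beta_reduce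
    rw [hy]
    ring
  · have hs' : |s| ≤ 1 := by
      rw [Metric.mem_ball, dist_zero_right, Real.norm_eq_abs] at hs
      exact hs.le
    have he : Real.exp (-(s - b y) ^ 2 / (2 * t)) ≤
        Real.exp (1 / (2 * t)) * Real.exp (-(1 / (4 * t)) * y ^ 2) := by
      refine (exp_neg_sub_sq_le ht s (b y)).trans ?_
      rw [← sq_abs (b y), hbabs, sq_abs]
      gcongr
      exact (sq_le_one_iff_abs_le_one s).2 hs'
    have hd : |(b y - s) / t| ≤ (1 + |y|) / t := by
      rw [abs_div, abs_of_pos ht]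
      gcongr
      have := abs_sub (b y) s
      rw [hbabs] at this
      linarith
    rw [Real.norm_eq_abs, abs_mul, abs_mul, Real.abs_exp]
    calc _ ≤ Real.exp (1 / (2 * t)) * Real.exp (-(1 / (4 * t)) * y ^ 2) * ((1 + |y|) / t) * M := by
          gcongr
          exact hM y
      _ = _ := by ring
  · have hsub : HasDerivAt (fun s : ℝ => -(s - b y) ^ 2 / (2 * t)) ((b y - s) / t) s := by
      refine ((((hasDerivAt_id' s).sub_const (b y)).fun_pow 2).fun_neg.div_const
        (2 * t)).congr_deriv ?_
      field_simp
      ring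
    exact hsub.exp.mul_const _

theorem skewSemigroup_eq_integral_add (α : ℝ) {φ : ℝ → ℝ} (hφ : Measurable φ) {M : ℝ}
    (hM : ∀ y, |φ y| ≤ M) (hM' : ∀ y, |Real.sign y * φ y| ≤ M) {t : ℝ} (ht : 0 < t) (x : ℝ) :
    skewSemigroup α t φ x = (Real.sqrt (2 * Real.pi * t))⁻¹ *
      ((∫ y, Real.exp (-(x - y) ^ 2 / (2 * t)) * φ y) + (2 * α - 1) *
        ∫ y, Real.exp (-(|x| - -|y|) ^ 2 / (2 * t)) * (Real.sign y * φ y)) := by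
  rw [← integral_const_mul, ← integral_add, ← integral_const_mul]
  · unfold skewSemigroup skewKernel heatKernel
    congr 1 with y
    rw [sub_neg_eq_add]
    ring
  · exact integrable_exp_neg_sub_sq_mul ht measurable_id (fun _ => rfl) hφ hM x
  · exact (integrable_exp_neg_sub_sq_mul ht (b := fun y => -|y|) (by fun_prop) (by simp)
      (Real.measurable_sign.mul hφ) hM' |x|).const_mul _

theorem skewSemigroup_transmission_condition (α : ℝ) (hα : α ∈ Set.Icc (0 : ℝ) 1)
    (φ : ℝ → ℝ) (hφc : Continuous φ) (hφb : ∃ M, ∀ x, |φ x| ≤ M)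
    (t : ℝ) (ht : 0 < t) :
    ∃ dp dm : ℝ,
      Tendsto (fun h => (skewSemigroup α t φ h - skewSemigroup α t φ 0) / h)
        (nhdsWithin 0 (Set.Ioi 0)) (nhds dp) ∧
      Tendsto (fun h => (skewSemigroup α t φ h - skewSemigroup α t φ 0) / h)
        (nhdsWithin 0 (Set.Iio 0)) (nhds dm) ∧
      α * dp = (1 - α) * dm := by
  obtain ⟨M, hM⟩ := hφb
  have hM' : ∀ y, |Real.sign y * φ y| ≤ M := fun y => by
    rw [abs_mul]
    refine (mul_le_of_le_one_left (abs_nonneg _) ?_).trans (hM y)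
    rcases Real.sign_apply_eq y with h | h | h <;> simp [h]
  set D := ∫ y, Real.exp (-y ^ 2 / (2 * t)) * (y * φ y / t) with hD
  set c := (Real.sqrt (2 * Real.pi * t))⁻¹ with hc
  have hG : HasDerivAt (fun s => ∫ y, Real.exp (-(s - y) ^ 2 / (2 * t)) * φ y) D 0 :=
    hasDerivAt_integral_exp_neg_sub_sq_mul ht measurable_id (fun _ => rfl) hφc.measurable hM
  have hK : HasDerivAt
      (fun s => ∫ y, Real.exp (-(s - -|y|) ^ 2 / (2 * t)) * (Real.sign y * φ y)) (-D) 0 := by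
    convert hasDerivAt_integral_exp_neg_sub_sq_mul ht (b := fun y => -|y|)
      (w := fun y => Real.sign y * φ y) (by fun_prop) (by simp)
      (Real.measurable_sign.mul hφc.measurable) hM' using 1
    rw [hD, ← integral_neg]
    congr 1 with y
    have hy : |y| * Real.sign y = y := by
      rcases lt_trichotomy y 0 with h | rfl | h
      · rw [Real.sign_of_neg h, abs_of_neg h]; ring
      · simp
      · rw [Real.sign_of_pos h, abs_of_pos h]; ring
    linear_combination (Real.exp (-y ^ 2 / (2 * t)) * φ y / t) * hy
  have hQ := skewSemigroup_eq_integral_add α hφc.measurable hM hM' ht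
  have hK' : HasDerivAt
      (fun s => ∫ y, Real.exp (-(-s - -|y|) ^ 2 / (2 * t)) * (Real.sign y * φ y)) D 0 := by
    refine (HasDerivAt.comp (0 : ℝ) (h := fun s : ℝ => -s) (neg_zero (G := ℝ) ▸ hK)
      (hasDerivAt_neg 0)).congr_deriv ?_
    ring
  refine ⟨c * (D + (2 * α - 1) * -D), c * (D + (2 * α - 1) * D), ?_, ?_, by ring⟩
  · have h := (hasDerivWithinAt_iff_tendsto_slope' Set.self_notMem_Ioi).1
      ((hG.add (hK.const_mul (2 * α - 1))).const_mul c).hasDerivWithinAt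
    refine h.congr' ?_
    filter_upwards [self_mem_nhdsWithin] with x hx
    rw [slope_def_field, hQ x, hQ 0, abs_of_pos hx, abs_zero, sub_zero]
    rfl
  · have h := (hasDerivWithinAt_iff_tendsto_slope' Set.self_notMem_Iio).1
      ((hG.add (hK'.const_mul (2 * α - 1))).const_mul c).hasDerivWithinAt
    refine h.congr' ?_
    filter_upwards [self_mem_nhdsWithin] with x hx
    rw [slope_def_field, hQ x, hQ 0, abs_of_neg hx, abs_zero, sub_zero]
    simp only [Pi.add_apply, neg_zero, hc]
end

section
/- (Uniqueness for the transmission problem.) Let α ∈ [0,1] and let φ : ℝ → ℝ be bounded and continuous. If u and v are two bounded functions on [0,∞) × ℝ, each continuous on [0,∞) × ℝ, equal to φ at t = 0, of class C^{1,2} on (0,∞) × (ℝ \ {0}) where each satisfies ∂w/∂t = (1/2)·∂²w/∂x², and each having one-sided spatial derivatives at x = 0 for every t > 0 satisfying α·∂_x w(t,0+) = (1−α)·∂_x w(t,0−), then u = v on [0,∞) × ℝ. -/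
open MeasureTheory Real Filter

/-- `u` is a (bounded-data) solution of the transmission problem of parameter `α`
with initial condition `φ`: it is continuous on `[0,∞) × ℝ`, equals `φ` at `t = 0`,
is `C²` in `x` and `C¹` in `t` at every point of `(0,∞) × (ℝ \ {0})` where it satisfies
the heat equation `∂u/∂t = (1/2)·∂²u/∂x²`, and for every `t > 0` the one-sided spatial
derivatives at `0` exist and satisfy the flux condition `α·∂ₓu(t,0+) = (1-α)·∂ₓu(t,0-)`. -/
def IsTransmissionSolution (α : ℝ) (φ : ℝ → ℝ) (u : ℝ → ℝ → ℝ) : Prop :=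
  (∀ x, u 0 x = φ x) ∧
  ContinuousOn (fun p : ℝ × ℝ => u p.1 p.2) (Set.Ici (0 : ℝ) ×ˢ (Set.univ : Set ℝ)) ∧
  (∀ t > (0 : ℝ), ∀ x : ℝ, x ≠ 0 →
    ContDiffAt ℝ 2 (fun x' => u t x') x ∧
    ContDiffAt ℝ 1 (fun s => u s x) t ∧
    deriv (fun s => u s x) t = (1 / 2) * iteratedDeriv 2 (fun x' => u t x') x) ∧
  (∀ t > (0 : ℝ), ∃ dp dm : ℝ,
    Filter.Tendsto (fun h => (u t h - u t 0) / h) (nhdsWithin 0 (Set.Ioi 0)) (nhds dp) ∧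
    Filter.Tendsto (fun h => (u t h - u t 0) / h) (nhdsWithin 0 (Set.Iio 0)) (nhds dm) ∧
    α * dp = (1 - α) * dm)

theorem IsLocalMax.iteratedDeriv_two_nonpos {f : ℝ → ℝ} {x : ℝ} (h : IsLocalMax f x)
    (hf : ContinuousAt f x) : iteratedDeriv 2 f x ≤ 0 := by
  by_contra! hpos
  have h2 : iteratedDeriv 2 f = deriv (deriv f) := by
    rw [iteratedDeriv_succ, iteratedDeriv_one]
  have hmin : IsLocalMin f x :=
    isLocalMin_of_deriv_deriv_pos (by rwa [← h2]) h.deriv_eq_zero hf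
  have hconst : f =ᶠ[nhds x] fun _ => f x := by
    filter_upwards [h, hmin] with y h₁ h₂ using le_antisymm h₁ h₂
  have := hconst.iteratedDeriv_eq 2
  rw [this, iteratedDeriv_const] at hpos
  simp at hpos

theorem HasDerivAt.nonneg_of_eventually_le_left {f : ℝ → ℝ} {d t : ℝ} (hd : HasDerivAt f d t)
    (h : ∀ᶠ s in nhdsWithin t (Set.Iio t), f s ≤ f t) : 0 ≤ d := by
  have hs := hasDerivAt_iff_tendsto_slope.1 hd
  have hs' := hs.mono_left (nhdsWithin_mono t (fun s (hs : s < t) => hs.ne) :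
    nhdsWithin t (Set.Iio t) ≤ _)
  refine ge_of_tendsto hs' ?_
  filter_upwards [h, self_mem_nhdsWithin] with s h₁ (h₂ : s < t)
  rw [slope_def_field]
  exact div_nonneg_of_nonpos (by linarith) (by linarith)

/-- The penalised difference of two solutions cannot attain its maximum over a strip in the
open half-plane `t > 0`: at `x ≠ 0` the penalty makes it a strict subsolution of the heat equation,
and at `x = 0` its kink violates the flux condition. -/
theorem IsTransmissionSolution.not_isMax_sub_penalty {α ε : ℝ} (hα : α ∈ Set.Icc (0 : ℝ) 1)
    (hε : 0 < ε) {φ : ℝ → ℝ} {u v : ℝ → ℝ → ℝ}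
    (hu : IsTransmissionSolution α φ u) (hv : IsTransmissionSolution α φ v) {t x : ℝ} (ht : 0 < t)
    (hx : ∀ᶠ y in nhds x, u t y - v t y - ε * (2 * t + y ^ 2 - |y| + 1) ≤
      u t x - v t x - ε * (2 * t + x ^ 2 - |x| + 1))
    (hs : ∀ᶠ s in nhdsWithin t (Set.Iio t),
      u s x - v s x - ε * (2 * s + x ^ 2 - |x| + 1) ≤
      u t x - v t x - ε * (2 * t + x ^ 2 - |x| + 1)) : False := by
  obtain ⟨-, -, hu3, hu4⟩ := hu
  obtain ⟨-, -, hv3, hv4⟩ := hv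
  obtain ⟨hα0, hα1⟩ := hα
  rcases eq_or_ne x 0 with rfl | hx0
  · obtain ⟨up, um, hup, hum, hue⟩ := hu4 t ht
    obtain ⟨vp, vm, hvp, hvm, hve⟩ := hv4 t ht
    have hid : Tendsto (fun h : ℝ => h) (nhds 0) (nhds 0) := tendsto_id
    have hp : up - vp ≤ ε * (0 - 1) := by
      have hr : Tendsto (fun h : ℝ => ε * (h - 1)) (nhdsWithin 0 (Set.Ioi 0))
          (nhds (ε * (0 - 1))) :=
        ((hid.sub_const 1).const_mul ε).mono_left nhdsWithin_le_nhds
      refine le_of_tendsto_of_tendsto (hup.sub hvp) hr ?_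
      filter_upwards [hx.filter_mono nhdsWithin_le_nhds, self_mem_nhdsWithin] with h h₁ (h₂ : 0 < h)
      rw [abs_of_pos h₂, abs_zero] at h₁
      rw [← sub_div, div_le_iff₀ h₂]
      nlinarith
    have hm : ε * (0 + 1) ≤ um - vm := by
      have hr : Tendsto (fun h : ℝ => ε * (h + 1)) (nhdsWithin 0 (Set.Iio 0))
          (nhds (ε * (0 + 1))) :=
        ((hid.add_const 1).const_mul ε).mono_left nhdsWithin_le_nhds
      refine le_of_tendsto_of_tendsto hr (hum.sub hvm) ?_
      filter_upwards [hx.filter_mono nhdsWithin_le_nhds, self_mem_nhdsWithin] with h h₁ (h₂ : h < 0)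
      rw [abs_of_neg h₂, abs_zero] at h₁
      rw [← sub_div, le_div_iff_of_neg h₂]
      nlinarith
    have h₁ := mul_le_mul_of_nonneg_left hp hα0
    have h₂ := mul_le_mul_of_nonneg_left hm (sub_nonneg.2 hα1)
    linarith
  · obtain ⟨hu₂, hu₁, hue⟩ := hu3 t ht x hx0
    obtain ⟨hv₂, hv₁, hve⟩ := hv3 t ht x hx0
    obtain ⟨σ, hσ⟩ : ∃ σ : ℝ, ∀ᶠ y in nhds x, |y| = σ * y := by
      rcases hx0.lt_or_gt with h | h
      · exact ⟨-1, by filter_upwards [Iio_mem_nhds h] with y hy; rw [abs_of_neg hy]; ring⟩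
      · exact ⟨1, by filter_upwards [Ioi_mem_nhds h] with y hy; rw [abs_of_pos hy]; ring⟩
    have hmax : IsLocalMax
        (((fun y => u t y) - fun y => v t y) - fun y => ε * (2 * t + y ^ 2 - σ * y + 1)) x := by
      filter_upwards [hx, hσ] with y h₁ h₂
      rw [h₂, hσ.self_of_nhds] at h₁
      exact h₁
    have hψ : ContDiff ℝ 2 (fun y : ℝ => ε * (2 * t + y ^ 2 - σ * y + 1)) := by fun_prop
    have hψ2 : iteratedDeriv 2 (fun y : ℝ => ε * (2 * t + y ^ 2 - σ * y + 1)) x = 2 * ε := by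
      have h₁ : deriv (fun y : ℝ => ε * (2 * t + y ^ 2 - σ * y + 1)) =
          fun y => ε * (2 * y - σ) := by
        funext y
        have := (((((hasDerivAt_id y).pow 2).const_add (2 * t)).sub
          ((hasDerivAt_id y).const_mul σ)).add_const 1).const_mul ε
        refine HasDerivAt.deriv (this.congr_deriv ?_)
        simp
      rw [iteratedDeriv_succ, iteratedDeriv_one, h₁]
      have := (((hasDerivAt_id x).const_mul 2).sub_const σ).const_mul ε
      refine HasDerivAt.deriv (this.congr_deriv ?_)
      ring
    have huv : ContDiffAt ℝ 2 ((fun y => u t y) - fun y => v t y) x := hu₂.sub hv₂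
    have hxx := hmax.iteratedDeriv_two_nonpos (huv.sub hψ.contDiffAt).continuousAt
    rw [iteratedDeriv_sub huv hψ.contDiffAt, iteratedDeriv_sub hu₂ hv₂, hψ2] at hxx
    have hdt := ((hu₁.differentiableAt one_ne_zero).hasDerivAt.sub
      (hv₁.differentiableAt one_ne_zero).hasDerivAt).sub
      ((((((hasDerivAt_id t).const_mul 2).add_const (x ^ 2)).sub_const |x|).add_const 1).const_mul ε)
    have htt := hdt.nonneg_of_eventually_le_left hs
    rw [hue, hve] at htt
    linarith

theorem IsTransmissionSolution.le_of_bounded {α : ℝ} (hα : α ∈ Set.Icc (0 : ℝ) 1)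
    {φ : ℝ → ℝ} {u v : ℝ → ℝ → ℝ}
    (hub : ∃ M, ∀ t ≥ (0 : ℝ), ∀ x, |u t x| ≤ M)
    (hvb : ∃ M, ∀ t ≥ (0 : ℝ), ∀ x, |v t x| ≤ M)
    (hu : IsTransmissionSolution α φ u) (hv : IsTransmissionSolution α φ v)
    {t : ℝ} (ht : 0 ≤ t) (x : ℝ) : u t x ≤ v t x := by
  obtain ⟨A, hA⟩ := hub
  obtain ⟨B, hB⟩ := hvb
  have key : ∀ ε > 0, u t x - v t x - ε * (2 * t + x ^ 2 - |x| + 1) ≤ 0 := by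
    intro ε hε
    by_contra! hpos
    set M := A + B
    have hw : ∀ s ≥ (0 : ℝ), ∀ y, u s y - v s y ≤ M := fun s hs y => by
      have h₁ := abs_le.1 (hA s hs y)
      have h₂ := abs_le.1 (hB s hs y)
      linarith
    have hM0 : 0 ≤ M := add_nonneg ((abs_nonneg _).trans (hA 0 le_rfl 0))
      ((abs_nonneg _).trans (hB 0 le_rfl 0))
    set R := M / ε + 2 with hR
    have hR2 : 2 ≤ R := by
      have : 0 ≤ M / ε := by positivity
      linarith
    have hfar : ∀ s ≥ (0 : ℝ), ∀ y, R ≤ |y| →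
        u s y - v s y - ε * (2 * s + y ^ 2 - |y| + 1) < 0 := by
      intro s hs y hy
      have h₁ := hw s hs y
      have h₂ : M = ε * (R - 2) := by rw [hR]; field_simp; ring
      have h₃ : R - 2 < 2 * s + y ^ 2 - |y| + 1 := by
        rw [← sq_abs]; nlinarith
      have := mul_lt_mul_of_pos_left h₃ hε
      linarith
    have hzero : ∀ y, u 0 y - v 0 y - ε * (2 * 0 + y ^ 2 - |y| + 1) < 0 := by
      intro y
      rw [hu.1, hv.1]
      have : 0 < 2 * 0 + y ^ 2 - |y| + 1 := by
        rw [← sq_abs]; nlinarith [sq_nonneg (|y| - 1 / 2)]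
      have := mul_pos hε this
      linarith
    have hcont : ContinuousOn
        (fun p : ℝ × ℝ => u p.1 p.2 - v p.1 p.2 - ε * (2 * p.1 + p.2 ^ 2 - |p.2| + 1))
        (Set.Icc 0 t ×ˢ Set.Icc (-R) R) := by
      refine ((hu.2.1.sub hv.2.1).sub (Continuous.continuousOn (by fun_prop))).mono ?_
      exact Set.prod_mono Set.Icc_subset_Ici_self (Set.subset_univ _)
    have hxR : |x| < R := by
      by_contra! h
      exact (hfar t ht x h).not_gt hpos
    have hmem : (t, x) ∈ Set.Icc 0 t ×ˢ Set.Icc (-R) R :=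
      ⟨⟨ht, le_rfl⟩, abs_le.1 hxR.le⟩
    obtain ⟨⟨s, y⟩, ⟨⟨hs0, hst⟩, hy⟩, hmax⟩ :=
      (isCompact_Icc.prod isCompact_Icc).exists_isMaxOn ⟨_, hmem⟩ hcont
    have hval : 0 < u s y - v s y - ε * (2 * s + y ^ 2 - |y| + 1) := hpos.trans_le (hmax hmem)
    have hspos : 0 < s := by
      refine hs0.lt_of_ne ?_
      rintro rfl
      exact (hzero y).not_gt hval
    have hyR : |y| < R := by
      by_contra! h
      exact (hfar s hs0 y h).not_gt hval
    refine hu.not_isMax_sub_penalty hα hε hv hspos (x := y) ?_ ?_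
    · filter_upwards [Icc_mem_nhds (abs_lt.1 hyR).1 (abs_lt.1 hyR).2] with y' hy'
      exact hmax (a := (s, y')) ⟨⟨hs0, hst⟩, hy'⟩
    · filter_upwards [Ioo_mem_nhdsLT hspos] with s' hs'
      exact hmax (a := (s', y)) ⟨⟨hs'.1.le, hs'.2.le.trans hst⟩, hy⟩
  have hlim : Tendsto (fun ε : ℝ => u t x - v t x - ε * (2 * t + x ^ 2 - |x| + 1))
      (nhdsWithin 0 (Set.Ioi 0)) (nhds (u t x - v t x - 0 * (2 * t + x ^ 2 - |x| + 1))) :=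
    (Continuous.tendsto (by fun_prop) 0).mono_left nhdsWithin_le_nhds
  have := le_of_tendsto hlim (by filter_upwards [self_mem_nhdsWithin] with ε hε using key ε hε)
  linarith

theorem transmission_uniqueness (α : ℝ) (hα : α ∈ Set.Icc (0 : ℝ) 1)
    (φ : ℝ → ℝ) (hφc : Continuous φ) (hφb : ∃ M, ∀ x, |φ x| ≤ M)
    (u v : ℝ → ℝ → ℝ)
    (hub : ∃ M, ∀ t ≥ (0 : ℝ), ∀ x, |u t x| ≤ M)
    (hvb : ∃ M, ∀ t ≥ (0 : ℝ), ∀ x, |v t x| ≤ M)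
    (hu : IsTransmissionSolution α φ u) (hv : IsTransmissionSolution α φ v) :
    ∀ t ≥ (0 : ℝ), ∀ x : ℝ, u t x = v t x := by
  intro t ht x
  exact le_antisymm (IsTransmissionSolution.le_of_bounded hα hub hvb hu hv ht x)
    (IsTransmissionSolution.le_of_bounded hα hvb hub hv hu ht x)
end

section
/- (Equality of the perturbation formula and the explicit formula for the Skew Brownian semigroup.) Let φ : ℝ → ℝ be bounded and continuous. Then for every t > 0 and every x ∈ ℝ, ∫_0^t p(t−τ, x, 0)·(∫_ℝ (y/(√(2π)·τ^{3/2}))·exp(−y²/(2τ))·φ(y) dy) dτ = ∫_0^∞ (2πt)^{-1/2}·exp(−(y+|x|)²/(2t))·(φ(y) − φ(−y)) dy; consequently, for every α ∈ [0,1] the semigroup defined by the single-layer perturbation of the heat semigroup with charge q = 2α−1 coincides with the semigroup Q_t with kernel q_α. -/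
open MeasureTheory Real Filter

/-- The integral over the line of an integrable function, folded onto the half-line. -/
theorem integral_eq_integral_Ioi_add_neg {f : ℝ → ℝ} (hf : Integrable f) :
    ∫ y, f y = ∫ y in Set.Ioi (0 : ℝ), (f y + f (-y)) := by
  have h : IntegrableOn (fun y => f (-y)) (Set.Ioi 0) := hf.comp_neg.integrableOn
  rw [integral_add hf.integrableOn h, integral_comp_neg_Ioi, neg_zero, add_comm,
    intervalIntegral.integral_Iic_add_Ioi hf.integrableOn hf.integrableOn]

/-- The Gaussian primitive `u ↦ ∫₀ᵘ exp(-v²/(2t)) dv`. -/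
noncomputable def gaussPrimitive (t u : ℝ) : ℝ :=
  ∫ v in (0 : ℝ)..u, Real.exp (-v ^ 2 / (2 * t))

theorem hasDerivAt_gaussPrimitive (t u : ℝ) :
    HasDerivAt (gaussPrimitive t) (Real.exp (-u ^ 2 / (2 * t))) u := by
  have hc : Continuous fun v : ℝ => Real.exp (-v ^ 2 / (2 * t)) := by fun_prop
  exact (hc.integral_hasStrictDerivAt 0 u).hasDerivAt

theorem gaussPrimitive_neg (t u : ℝ) : gaussPrimitive t (-u) = -gaussPrimitive t u := by
  have h := intervalIntegral.integral_comp_neg (a := 0) (b := u)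
    (fun v : ℝ => Real.exp (-v ^ 2 / (2 * t)))
  simp only [neg_sq, neg_zero] at h
  rw [gaussPrimitive, gaussPrimitive, h, intervalIntegral.integral_symm]

theorem tendsto_gaussPrimitive_atTop {t : ℝ} (ht : 0 < t) :
    Tendsto (gaussPrimitive t) atTop (nhds (√(2 * π * t) / 2)) := by
  have h := integral_gaussian_Ioi (2 * t)⁻¹
  have hi := (integrable_exp_neg_mul_sq (b := (2 * t)⁻¹) (by positivity)).integrableOn (s := Set.Ioi 0)
  have hfun : (fun v : ℝ => Real.exp (-(2 * t)⁻¹ * v ^ 2)) = fun v => Real.exp (-v ^ 2 / (2 * t)) := by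
    ext v; congr 1; field_simp
  rw [hfun] at h hi
  have := intervalIntegral_tendsto_integral_Ioi 0 hi tendsto_id
  rw [h] at this
  convert this using 3
  congr 1
  field_simp

theorem tendsto_gaussPrimitive_atBot {t : ℝ} (ht : 0 < t) :
    Tendsto (gaussPrimitive t) atBot (nhds (-(√(2 * π * t) / 2))) := by
  have h := ((tendsto_gaussPrimitive_atTop ht).comp tendsto_neg_atBot_atTop).neg
  refine h.congr fun u => ?_
  simp [gaussPrimitive_neg]

theorem gaussPrimitive_zero (t : ℝ) : gaussPrimitive t 0 = 0 := by
  simp [gaussPrimitive]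

theorem integrableOn_rpow_mul_sub_rpow {t : ℝ} (ht : 0 < t) :
    IntegrableOn (fun τ : ℝ => τ ^ (-(1 / 2) : ℝ) * (t - τ) ^ (-(1 / 2) : ℝ)) (Set.Ioo 0 t) := by
  have h1 : IntegrableOn (fun τ : ℝ => τ ^ (-(1 / 2) : ℝ)) (Set.Ioo 0 t) := by
    rw [← intervalIntegrable_iff_integrableOn_Ioo_of_le ht.le]
    exact intervalIntegral.intervalIntegrable_rpow' (by norm_num)
  have h2 : IntegrableOn (fun τ : ℝ => (t - τ) ^ (-(1 / 2) : ℝ)) (Set.Ioo 0 t) := by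
    rw [← intervalIntegrable_iff_integrableOn_Ioo_of_le ht.le]
    have := (intervalIntegral.intervalIntegrable_rpow' (a := 0) (b := t) (r := -(1 / 2))
      (by norm_num)).comp_sub_left t
    simpa using this.symm
  refine ((h1.add h2).const_mul ((t / 2) ^ (-(1 / 2) : ℝ))).mono'
    (by measurability) ?_
  filter_upwards [ae_restrict_mem measurableSet_Ioo] with τ hτ
  have p1 : 0 ≤ τ ^ (-(1 / 2) : ℝ) := Real.rpow_nonneg hτ.1.le _
  have p2 : 0 ≤ (t - τ) ^ (-(1 / 2) : ℝ) := Real.rpow_nonneg (by linarith [hτ.2]) _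
  have p3 : 0 ≤ (t / 2) ^ (-(1 / 2) : ℝ) := by positivity
  rw [Real.norm_of_nonneg (mul_nonneg p1 p2)]
  simp only [Pi.add_apply]
  rcases le_total τ (t / 2) with h | h
  · have : (t - τ) ^ (-(1 / 2) : ℝ) ≤ (t / 2) ^ (-(1 / 2) : ℝ) :=
      Real.rpow_le_rpow_of_nonpos (by positivity) (by linarith) (by norm_num)
    nlinarith [mul_le_mul_of_nonneg_left this p1, mul_nonneg p3 p2]
  · have : τ ^ (-(1 / 2) : ℝ) ≤ (t / 2) ^ (-(1 / 2) : ℝ) :=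
      Real.rpow_le_rpow_of_nonpos (by positivity) (by linarith) (by norm_num)
    nlinarith [mul_le_mul_of_nonneg_left this p2, mul_nonneg p3 p1]

theorem hasDerivAt_sqrt_sub_div_sqrt {t τ : ℝ} (hτ : τ ∈ Set.Ioo 0 t) :
    HasDerivAt (fun σ => √(t - σ) / √σ) (-t / (2 * √(t - τ) * √τ ^ 3)) τ := by
  have hu : 0 < t - τ := sub_pos.2 hτ.2
  have hp := Real.sqrt_pos.2 hu
  have hq := Real.sqrt_pos.2 hτ.1
  have h1 := ((hasDerivAt_id τ).const_sub t).sqrt hu.ne'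
  have h2 := (hasDerivAt_id τ).sqrt hτ.1.ne'
  refine (h1.div h2 hq.ne').congr_deriv ?_
  have e1 := Real.sq_sqrt hu.le
  have e2 := Real.sq_sqrt hτ.1.le
  simp only [id]
  have e3 : t = √(t - τ) ^ 2 + √τ ^ 2 := by rw [e1, e2]; ring
  generalize √(t - τ) = p at *
  generalize √τ = q at *
  subst e3
  field_simp
  ring

theorem tendsto_sqrt_sub_div_sqrt_zero {t : ℝ} (ht : 0 < t) :
    Tendsto (fun σ => √(t - σ) / √σ) (nhdsWithin 0 (Set.Ioi 0)) atTop := by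
  have h1 : Tendsto (fun σ => √(t - σ)) (nhdsWithin 0 (Set.Ioi 0)) (nhds √(t - 0)) :=
    (Continuous.tendsto (by fun_prop) 0).mono_left nhdsWithin_le_nhds
  have h2 : Tendsto (fun σ => √σ) (nhdsWithin 0 (Set.Ioi 0)) (nhdsWithin 0 (Set.Ioi 0)) := by
    refine tendsto_nhdsWithin_iff.2 ⟨?_, ?_⟩
    · simpa using (Real.continuous_sqrt.tendsto 0).mono_left (nhdsWithin_le_nhds (s := Set.Ioi 0))
    · filter_upwards [self_mem_nhdsWithin] with σ hσ using Real.sqrt_pos.2 hσ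
  simp only [div_eq_mul_inv]
  exact h1.pos_mul_atTop (by simpa using ht) (tendsto_inv_nhdsGT_zero.comp h2)

theorem tendsto_sqrt_sub_div_sqrt_right {t : ℝ} (ht : 0 < t) :
    Tendsto (fun σ => √(t - σ) / √σ) (nhdsWithin t (Set.Iio t)) (nhdsWithin 0 (Set.Ioi 0)) := by
  refine tendsto_nhdsWithin_iff.2 ⟨?_, ?_⟩
  · have h : ContinuousAt (fun σ => √(t - σ) / √σ) t :=
      ContinuousAt.div (by fun_prop) (by fun_prop) (Real.sqrt_pos.2 ht).ne'
    simpa using h.tendsto.mono_left (nhdsWithin_le_nhds (s := Set.Iio t))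
  · filter_upwards [Ioo_mem_nhdsLT ht] with σ hσ
    exact div_pos (Real.sqrt_pos.2 (sub_pos.2 hσ.2)) (Real.sqrt_pos.2 hσ.1)

/-- A primitive of `s ↦ 2y exp(-(ys-a/s)²/(2t))` on the positive half-line. -/
noncomputable def schlomilchPrimitive (t a y s : ℝ) : ℝ :=
  gaussPrimitive t (y * s - a / s) +
    Real.exp (2 * a * y / t) * gaussPrimitive t (y * s + a / s)

theorem hasDerivAt_schlomilchPrimitive {t a y s : ℝ} (ht : 0 < t) (hs : 0 < s) :
    HasDerivAt (schlomilchPrimitive t a y)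
      (2 * y * Real.exp (-(y * s - a / s) ^ 2 / (2 * t))) s := by
  have h1 : HasDerivAt (fun s : ℝ => y * s) y s := by
    simpa using (hasDerivAt_id s).const_mul y
  have h2 : HasDerivAt (fun s : ℝ => a / s) (-(a / s ^ 2)) s := by
    simpa [div_eq_mul_inv] using (hasDerivAt_inv hs.ne').const_mul a
  have h3 := (hasDerivAt_gaussPrimitive t (y * s - a / s)).comp s (h1.sub h2)
  have h4 := ((hasDerivAt_gaussPrimitive t (y * s + a / s)).comp s (h1.add h2)).const_mul
    (Real.exp (2 * a * y / t))
  refine (h3.add h4).congr_deriv ?_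
  have e : Real.exp (2 * a * y / t) * Real.exp (-(y * s + a / s) ^ 2 / (2 * t))
      = Real.exp (-(y * s - a / s) ^ 2 / (2 * t)) := by
    rw [← Real.exp_add]
    congr 1
    field_simp
    ring
  rw [← mul_assoc, e]
  ring

theorem tendsto_schlomilchPrimitive_atTop {t a y : ℝ} (ht : 0 < t) (hy : 0 < y) :
    Tendsto (schlomilchPrimitive t a y) atTop
      (nhds (√(2 * π * t) / 2 + Real.exp (2 * a * y / t) * (√(2 * π * t) / 2))) := by
  have h1 : Tendsto (fun s : ℝ => y * s) atTop atTop := tendsto_id.const_mul_atTop hy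
  have h2 : Tendsto (fun s : ℝ => a / s) atTop (nhds 0) := tendsto_const_nhds.div_atTop tendsto_id
  have h3 := (tendsto_gaussPrimitive_atTop ht).comp (h1.atTop_add h2.neg)
  have h4 := (tendsto_gaussPrimitive_atTop ht).comp (h1.atTop_add h2)
  exact (h3.add (h4.const_mul _)).congr fun s => by
    simp [schlomilchPrimitive, sub_eq_add_neg]

theorem tendsto_schlomilchPrimitive_zero {t a y : ℝ} (ht : 0 < t) (ha : 0 ≤ a) :
    Tendsto (schlomilchPrimitive t a y) (nhdsWithin 0 (Set.Ioi 0))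
      (nhds (-(√(2 * π * t) / 2) + Real.exp (2 * a * y / t) * (√(2 * π * t) / 2))) := by
  have h1 : Tendsto (fun s : ℝ => y * s) (nhdsWithin 0 (Set.Ioi 0)) (nhds (y * 0)) :=
    (Continuous.tendsto (by fun_prop) 0).mono_left nhdsWithin_le_nhds
  rcases ha.eq_or_lt with rfl | ha
  · have h0 := (hasDerivAt_gaussPrimitive t (y * 0)).continuousAt.tendsto.comp h1
    have h := h0.add h0
    simp only [mul_zero, gaussPrimitive_zero, add_zero] at h
    have e : -(√(2 * π * t) / 2) + Real.exp (2 * 0 * y / t) * (√(2 * π * t) / 2) = 0 := by simp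
    rw [e]
    exact h.congr fun s => by simp [schlomilchPrimitive]
  · have h2 : Tendsto (fun s : ℝ => a / s) (nhdsWithin 0 (Set.Ioi 0)) atTop :=
      tendsto_inv_nhdsGT_zero.const_mul_atTop ha
    have h3 := (tendsto_gaussPrimitive_atBot ht).comp
      (h1.add_atBot (tendsto_neg_atTop_atBot.comp h2))
    have h4 := (tendsto_gaussPrimitive_atTop ht).comp (h1.add_atTop h2)
    exact (h3.add (h4.const_mul _)).congr fun s => by
      simp [schlomilchPrimitive, sub_eq_add_neg]

/-- The density at time `τ` of the first passage time of Brownian motion at level `y`, extended to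
an odd function of `y`. -/
noncomputable def passageDensity (τ y : ℝ) : ℝ :=
  (y / (√(2 * π) * τ ^ ((3 : ℝ) / 2))) * Real.exp (-y ^ 2 / (2 * τ))

theorem rpow_three_halves {τ : ℝ} (hτ : 0 ≤ τ) : τ ^ ((3 : ℝ) / 2) = √τ ^ 3 := by
  rw [Real.sqrt_eq_rpow, ← Real.rpow_natCast, ← Real.rpow_mul hτ]
  norm_num

theorem heatKernel_mul_passageDensity {t τ : ℝ} (hτ : τ ∈ Set.Ioo 0 t) (a y : ℝ) :
    heatKernel (t - τ) a 0 * passageDensity τ y =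
      -((2 * π * t)⁻¹ * Real.exp (-(y + a) ^ 2 / (2 * t))) *
        (2 * y * Real.exp (-(y * (√(t - τ) / √τ) - a / (√(t - τ) / √τ)) ^ 2 / (2 * t)) *
          (-t / (2 * √(t - τ) * √τ ^ 3))) := by
  have hu : 0 < t - τ := sub_pos.2 hτ.2
  have hp := Real.sqrt_pos.2 hu
  have hq := Real.sqrt_pos.2 hτ.1
  have e1 := Real.sq_sqrt hu.le
  have e2 := Real.sq_sqrt hτ.1.le
  have ht : 0 < t := hτ.1.trans hτ.2
  have hE : Real.exp (-(a - 0) ^ 2 / (2 * (t - τ))) * Real.exp (-y ^ 2 / (2 * τ)) =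
      Real.exp (-(y + a) ^ 2 / (2 * t)) *
        Real.exp (-(y * (√(t - τ) / √τ) - a / (√(t - τ) / √τ)) ^ 2 / (2 * t)) := by
    rw [← Real.exp_add, ← Real.exp_add]
    congr 1
    have e3 : t = √(t - τ) ^ 2 + √τ ^ 2 := by rw [e1, e2]; ring
    generalize √(t - τ) = p at *
    generalize √τ = q at *
    rw [← e1, ← e2, e3]
    field_simp
    ring
  have hpi : √(2 * π) * √(2 * π) = 2 * π := Real.mul_self_sqrt (by positivity)
  have hpi0 : 0 < √(2 * π) := by positivity
  rw [heatKernel, passageDensity, rpow_three_halves hτ.1.le,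
    Real.sqrt_mul (by positivity) (t - τ)]
  calc _ = (√(2 * π) * √(t - τ))⁻¹ * (y / (√(2 * π) * √τ ^ 3)) *
        (Real.exp (-(a - 0) ^ 2 / (2 * (t - τ))) * Real.exp (-y ^ 2 / (2 * τ))) := by ring
    _ = _ := by
      rw [hE]
      generalize √(2 * π) = r at *
      rw [← hpi]
      field_simp

/-- The first passage decomposition of the heat kernel. -/
theorem integral_heatKernel_mul_passageDensity {t a y : ℝ} (ht : 0 < t) (ha : 0 ≤ a) (hy : 0 < y)
    (hi : IntegrableOn (fun τ => heatKernel (t - τ) a 0 * passageDensity τ y) (Set.Ioo 0 t)) :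
    ∫ τ in Set.Ioo 0 t, heatKernel (t - τ) a 0 * passageDensity τ y =
      (√(2 * π * t))⁻¹ * Real.exp (-(y + a) ^ 2 / (2 * t)) := by
  set c := -((2 * π * t)⁻¹ * Real.exp (-(y + a) ^ 2 / (2 * t))) with hc
  have hd : ∀ τ ∈ Set.Ioo 0 t, HasDerivAt
      (fun σ => c * schlomilchPrimitive t a y (√(t - σ) / √σ))
      (heatKernel (t - τ) a 0 * passageDensity τ y) τ := by
    intro τ hτ
    rw [heatKernel_mul_passageDensity hτ]
    have hs : 0 < √(t - τ) / √τ :=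
      div_pos (Real.sqrt_pos.2 (sub_pos.2 hτ.2)) (Real.sqrt_pos.2 hτ.1)
    exact ((hasDerivAt_schlomilchPrimitive ht hs).comp τ
      (hasDerivAt_sqrt_sub_div_sqrt hτ)).const_mul c
  have h := intervalIntegral.integral_eq_sub_of_hasDerivAt_of_tendsto ht hd
    ((intervalIntegrable_iff_integrableOn_Ioo_of_le ht.le).2 hi)
    (((tendsto_schlomilchPrimitive_atTop ht hy).comp
      (tendsto_sqrt_sub_div_sqrt_zero ht)).const_mul c)
    (((tendsto_schlomilchPrimitive_zero ht ha).comp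
      (tendsto_sqrt_sub_div_sqrt_right ht)).const_mul c)
  rw [intervalIntegral.integral_of_le ht.le, integral_Ioc_eq_integral_Ioo] at h
  have hpos : 0 < √(2 * π * t) := by positivity
  have hsq : √(2 * π * t) * √(2 * π * t) = 2 * π * t := Real.mul_self_sqrt (by positivity)
  rw [h, hc]
  generalize √(2 * π * t) = r at *
  rw [← hsq]
  field_simp
  ring

theorem integrable_passageDensity {τ : ℝ} (hτ : 0 < τ) : Integrable (passageDensity τ) := by
  have h := (integrable_mul_exp_neg_mul_sq (b := (2 * τ)⁻¹) (by positivity)).const_mul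
    (√(2 * π) * τ ^ ((3 : ℝ) / 2))⁻¹
  refine h.congr (ae_of_all _ fun y => ?_)
  have : -(2 * τ)⁻¹ * y ^ 2 = -y ^ 2 / (2 * τ) := by field_simp
  simp only [passageDensity, this]
  ring

theorem integral_passageDensity {τ : ℝ} (hτ : 0 < τ) :
    ∫ y in Set.Ioi 0, passageDensity τ y = (√(2 * π))⁻¹ * τ ^ (-(1 / 2) : ℝ) := by
  have h := integral_rpow_mul_exp_neg_mul_rpow (p := 2) (q := 1) (b := (2 * τ)⁻¹) (by norm_num)
    (by norm_num) (by positivity)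
  have e : ∀ y : ℝ, passageDensity τ y = (√(2 * π) * τ ^ ((3 : ℝ) / 2))⁻¹ *
      (y ^ (1 : ℝ) * Real.exp (-(2 * τ)⁻¹ * y ^ (2 : ℝ))) := by
    intro y
    have : -(2 * τ)⁻¹ * y ^ 2 = -y ^ 2 / (2 * τ) := by field_simp
    rw [Real.rpow_one, Real.rpow_two, this, passageDensity]
    ring
  simp only [e]
  rw [integral_const_mul, h]
  have e2 : τ ^ (-(1 / 2) : ℝ) = (√τ)⁻¹ := by
    rw [Real.rpow_neg hτ.le, ← Real.sqrt_eq_rpow]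
  have hq := Real.sqrt_pos.2 hτ
  have e3 := Real.sq_sqrt hτ.le
  norm_num [Real.rpow_neg_one]
  rw [rpow_three_halves hτ.le, e2]
  field_simp
  nlinarith

theorem heatKernel_le {t : ℝ} (ht : 0 < t) (a : ℝ) :
    heatKernel t a 0 ≤ (√(2 * π))⁻¹ * t ^ (-(1 / 2) : ℝ) := by
  have e2 : t ^ (-(1 / 2) : ℝ) = (√t)⁻¹ := by
    rw [Real.rpow_neg ht.le, ← Real.sqrt_eq_rpow]
  rw [heatKernel, Real.sqrt_mul (by positivity), mul_inv, e2]
  refine mul_le_of_le_one_right (by positivity) (Real.exp_le_one_iff.2 ?_)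
  rw [neg_div]
  exact neg_nonpos.2 (by positivity)

theorem heatKernel_nonneg (t x y : ℝ) : 0 ≤ heatKernel t x y := by
  unfold heatKernel; positivity

theorem measurable_heatKernel_mul_passageDensity (t a : ℝ) :
    Measurable fun p : ℝ × ℝ => heatKernel (t - p.1) a 0 * passageDensity p.1 p.2 := by
  unfold heatKernel passageDensity
  fun_prop

theorem integrable_heatKernel_mul_passageDensity {t : ℝ} (ht : 0 < t) (a : ℝ) :
    Integrable (fun p : ℝ × ℝ => heatKernel (t - p.1) a 0 * passageDensity p.1 p.2)
      ((volume.restrict (Set.Ioo 0 t)).prod (volume.restrict (Set.Ioi 0))) := by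
  have hm := measurable_heatKernel_mul_passageDensity t a
  rw [integrable_prod_iff hm.aestronglyMeasurable]
  constructor
  · filter_upwards [ae_restrict_mem measurableSet_Ioo] with τ hτ
    exact ((integrable_passageDensity hτ.1).const_mul _).integrableOn
  · refine ((integrableOn_rpow_mul_sub_rpow ht).const_mul ((√(2 * π))⁻¹ * (√(2 * π))⁻¹)).mono'
      hm.norm.stronglyMeasurable.integral_prod_right.aestronglyMeasurable ?_
    filter_upwards [ae_restrict_mem measurableSet_Ioo] with τ hτ
    have e : ∫ y in Set.Ioi 0, ‖heatKernel (t - τ) a 0 * passageDensity τ y‖ =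
        heatKernel (t - τ) a 0 * ((√(2 * π))⁻¹ * τ ^ (-(1 / 2) : ℝ)) := by
      rw [← integral_passageDensity hτ.1, ← integral_const_mul]
      refine setIntegral_congr_fun measurableSet_Ioi fun y hy => Real.norm_of_nonneg ?_
      have hy' : 0 < y := hy
      have := hτ.1
      exact mul_nonneg (heatKernel_nonneg _ _ _) (by unfold passageDensity; positivity)
    have hτ0 := hτ.1
    rw [e, Real.norm_of_nonneg (mul_nonneg (heatKernel_nonneg _ _ _) (by positivity))]
    calc _ ≤ ((√(2 * π))⁻¹ * (t - τ) ^ (-(1 / 2) : ℝ)) * ((√(2 * π))⁻¹ * τ ^ (-(1 / 2) : ℝ)) :=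
          mul_le_mul_of_nonneg_right (heatKernel_le (sub_pos.2 hτ.2) a) (by positivity)
      _ = _ := by ring

theorem passageDensity_neg (τ y : ℝ) : passageDensity τ (-y) = -passageDensity τ y := by
  simp only [passageDensity, neg_sq]; ring

theorem integral_passageDensity_mul {φ : ℝ → ℝ} (hφc : Continuous φ) {M : ℝ}
    (hM : ∀ x, |φ x| ≤ M) {τ : ℝ} (hτ : 0 < τ) :
    ∫ y, passageDensity τ y * φ y = ∫ y in Set.Ioi 0, passageDensity τ y * (φ y - φ (-y)) := by
  rw [integral_eq_integral_Ioi_add_neg ((integrable_passageDensity hτ).mul_bdd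
    hφc.aestronglyMeasurable (ae_of_all _ hM))]
  simp only [passageDensity_neg]
  congr 1 with y
  ring

theorem integral_heatKernel_mul_integral_passageDensity {φ : ℝ → ℝ} (hφc : Continuous φ) {M : ℝ}
    (hM : ∀ x, |φ x| ≤ M) {t a : ℝ} (ht : 0 < t) (ha : 0 ≤ a) :
    ∫ τ in Set.Ioo 0 t, heatKernel (t - τ) a 0 * ∫ y, passageDensity τ y * φ y =
      ∫ y in Set.Ioi 0, (√(2 * π * t))⁻¹ * Real.exp (-(y + a) ^ 2 / (2 * t)) *
        (φ y - φ (-y)) := by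
  have hK := integrable_heatKernel_mul_passageDensity ht a
  have hψ : ∀ y, ‖φ y - φ (-y)‖ ≤ M + M := fun y =>
    (norm_sub_le _ _).trans (add_le_add (hM y) (hM (-y)))
  have hP : Integrable (Function.uncurry fun τ y =>
      heatKernel (t - τ) a 0 * passageDensity τ y * (φ y - φ (-y)))
      ((volume.restrict (Set.Ioo 0 t)).prod (volume.restrict (Set.Ioi 0))) :=
    hK.mul_bdd (g := fun p : ℝ × ℝ => φ p.2 - φ (-p.2))
      (Continuous.aestronglyMeasurable (by fun_prop)) (ae_of_all _ fun p => hψ p.2)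
  calc _ = ∫ τ in Set.Ioo 0 t, ∫ y in Set.Ioi 0,
        heatKernel (t - τ) a 0 * passageDensity τ y * (φ y - φ (-y)) := by
        refine setIntegral_congr_fun measurableSet_Ioo fun τ hτ => ?_
        simp only [integral_passageDensity_mul hφc hM hτ.1, ← integral_const_mul, mul_assoc]
    _ = ∫ y in Set.Ioi 0, ∫ τ in Set.Ioo 0 t,
        heatKernel (t - τ) a 0 * passageDensity τ y * (φ y - φ (-y)) := integral_integral_swap hP
    _ = _ := by
        refine integral_congr_ae ?_
        filter_upwards [hK.prod_left_ae, ae_restrict_mem measurableSet_Ioi] with y hy hy0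
        rw [integral_mul_const, integral_heatKernel_mul_passageDensity ht ha hy0 hy]

theorem integrable_heatKernel_mul {φ : ℝ → ℝ} (hφc : Continuous φ) {M : ℝ}
    (hM : ∀ x, |φ x| ≤ M) {t : ℝ} (ht : 0 < t) (x : ℝ) :
    Integrable fun y => heatKernel t x y * φ y := by
  refine Integrable.mul_bdd ?_ hφc.aestronglyMeasurable (ae_of_all _ hM)
  have h := ((integrable_exp_neg_mul_sq (b := (2 * t)⁻¹) (by positivity)).comp_sub_left x).const_mul
    (√(2 * π * t))⁻¹
  refine h.congr (ae_of_all _ fun y => ?_)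
  have : -(2 * t)⁻¹ * (x - y) ^ 2 = -(x - y) ^ 2 / (2 * t) := by field_simp
  simp only [heatKernel, this]

theorem integrable_sign_mul_exp_mul {φ : ℝ → ℝ} (hφc : Continuous φ) {M : ℝ}
    (hM : ∀ x, |φ x| ≤ M) {t : ℝ} (ht : 0 < t) (x : ℝ) :
    Integrable fun y => Real.sign y * ((√(2 * π * t))⁻¹ *
      Real.exp (-(|x| + |y|) ^ 2 / (2 * t))) * φ y := by
  refine Integrable.mul_bdd ?_ hφc.aestronglyMeasurable (ae_of_all _ hM)
  have hsign : Measurable Real.sign := by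
    unfold Real.sign
    exact Measurable.ite measurableSet_Iio measurable_const
      (Measurable.ite measurableSet_Ioi measurable_const measurable_const)
  have h := (integrable_exp_neg_mul_sq (b := (2 * t)⁻¹) (by positivity)).const_mul
    (√(2 * π * t))⁻¹
  refine Integrable.bdd_mul (c := 1) (h.mono' (Continuous.aestronglyMeasurable (by fun_prop))
    (ae_of_all _ fun y => ?_)) hsign.aestronglyMeasurable (ae_of_all _ fun y => ?_)
  · rw [Real.norm_of_nonneg (by positivity)]
    gcongr
    rw [neg_mul, neg_div, neg_le_neg_iff, inv_mul_eq_div]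
    gcongr ?_ / _
    rw [← sq_abs y]
    gcongr
    linarith [abs_nonneg x]
  · rcases Real.sign_apply_eq y with h | h | h <;> simp [h]

theorem integral_sign_mul_exp_mul {φ : ℝ → ℝ} (hφc : Continuous φ) {M : ℝ}
    (hM : ∀ x, |φ x| ≤ M) {t : ℝ} (ht : 0 < t) (x : ℝ) :
    ∫ y, Real.sign y * ((√(2 * π * t))⁻¹ * Real.exp (-(|x| + |y|) ^ 2 / (2 * t))) * φ y =
      ∫ y in Set.Ioi 0, (√(2 * π * t))⁻¹ * Real.exp (-(y + |x|) ^ 2 / (2 * t)) *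
        (φ y - φ (-y)) := by
  rw [integral_eq_integral_Ioi_add_neg (integrable_sign_mul_exp_mul hφc hM ht x)]
  refine setIntegral_congr_fun measurableSet_Ioi fun y hy => ?_
  have hy' : 0 < y := hy
  simp only [Real.sign_of_pos hy', Real.sign_of_neg (neg_lt_zero.2 hy'), abs_neg,
    abs_of_pos hy', add_comm |x| y]
  ring

theorem skew_perturbation_eq_explicit (φ : ℝ → ℝ) (hφc : Continuous φ)
    (hφb : ∃ M, ∀ x, |φ x| ≤ M) (t : ℝ) (ht : 0 < t) (x : ℝ) :
    (∫ τ in Set.Ioo (0 : ℝ) t, heatKernel (t - τ) x 0 *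
        ∫ y, (y / (Real.sqrt (2 * Real.pi) * τ ^ ((3 : ℝ) / 2))) *
          Real.exp (-y ^ 2 / (2 * τ)) * φ y)
      = (∫ y in Set.Ioi (0 : ℝ), (Real.sqrt (2 * Real.pi * t))⁻¹ *
          Real.exp (-(y + |x|) ^ 2 / (2 * t)) * (φ y - φ (-y))) ∧
    ∀ α ∈ Set.Icc (0 : ℝ) 1,
      (∫ y, heatKernel t x y * φ y) +
        (2 * α - 1) * (∫ τ in Set.Ioo (0 : ℝ) t, heatKernel (t - τ) x 0 *
          ∫ y, (y / (Real.sqrt (2 * Real.pi) * τ ^ ((3 : ℝ) / 2))) *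
            Real.exp (-y ^ 2 / (2 * τ)) * φ y)
        = skewSemigroup α t φ x := by
  obtain ⟨M, hM⟩ := hφb
  have main : (∫ τ in Set.Ioo (0 : ℝ) t, heatKernel (t - τ) x 0 *
        ∫ y, (y / (Real.sqrt (2 * Real.pi) * τ ^ ((3 : ℝ) / 2))) *
          Real.exp (-y ^ 2 / (2 * τ)) * φ y)
      = (∫ y in Set.Ioi (0 : ℝ), (Real.sqrt (2 * Real.pi * t))⁻¹ *
          Real.exp (-(y + |x|) ^ 2 / (2 * t)) * (φ y - φ (-y))) := by
    rw [← integral_heatKernel_mul_integral_passageDensity hφc hM ht (abs_nonneg x)]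
    simp only [heatKernel, passageDensity, sub_zero, sq_abs]
  refine ⟨main, fun α _ => ?_⟩
  rw [main, ← integral_sign_mul_exp_mul hφc hM ht x, ← integral_const_mul,
    ← integral_add (integrable_heatKernel_mul hφc hM ht x)
      ((integrable_sign_mul_exp_mul hφc hM ht x).const_mul _), skewSemigroup]
  congr 1 with y
  rw [skewKernel]
  ring
end
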